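/- Let Z be a T × T complex invertible matrix satisfying ‖Z‖_F² ≤ C (so every eigenvalue of ZZ† is at most C), and let Z_R be the n_t × T matrix formed by some n_t of the rows of Z. Then det(Z_R Z_R†) ≥ det(Z Z†) / C^{T − n_t}. -/

import Mathlib

open Matrix

open scoped ComplexOrder in
lemma aux_det_le {n : Type*} [Fintype n] [DecidableEq n] (S : Matrix n n ℂ) (hS : S.PosSemidef)
    (C : ℝ) (hC : S.trace.re ≤ C) : S.det.re ≤ C ^ Fintype.card n := by
  have h1 := hS.isHermitian.det_eq_prod_eigenvalues
  have h2 := hS.isHermitian.trace_eq_sum_eigenvalues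
  have h3 : S.det.re = ∏ i, hS.isHermitian.eigenvalues i := by
    rw [h1, ← RCLike.ofReal_prod]; exact Complex.ofReal_re _
  have h4 : S.trace.re = ∑ i, hS.isHermitian.eigenvalues i := by
    rw [h2, ← RCLike.ofReal_sum]; exact Complex.ofReal_re _
  rw [h3, ← Finset.card_univ, ← Finset.prod_const]
  apply Finset.prod_le_prod
  · intro i _; exact hS.eigenvalues_nonneg i
  · intro i _
    refine le_trans ?_ (h4 ▸ hC)
    exact Finset.single_le_sum (f := hS.isHermitian.eigenvalues)
      (fun j _ => hS.eigenvalues_nonneg j) (Finset.mem_univ i)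

open scoped ComplexOrder in
lemma aux_fischer {m n : Type*} [Fintype m] [DecidableEq m] [Fintype n] [DecidableEq n]
    (A : Matrix m m ℂ) (B : Matrix m n ℂ) (D : Matrix n n ℂ)
    (h : (fromBlocks A B Bᴴ D).PosSemidef) (hA : A.PosDef)
    (C : ℝ) (hC : D.trace.re ≤ C) :
    (fromBlocks A B Bᴴ D).det.re ≤ A.det.re * C ^ Fintype.card n := by
  have hAu : IsUnit A := hA.isUnit
  letI : Invertible A := hAu.invertible
  have hS : (D - Bᴴ * A⁻¹ * B).PosSemidef := (PosDef.fromBlocks₁₁ B D hA).1 h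
  have hd : (fromBlocks A B Bᴴ D).det = A.det * (D - Bᴴ * A⁻¹ * B).det := by
    rw [det_fromBlocks₁₁, invOf_eq_nonsing_inv]
  have hP : (Bᴴ * A⁻¹ * B).PosSemidef := hA.inv.posSemidef.conjTranspose_mul_mul_same B
  have hApos := Complex.pos_iff.1 hA.det_pos
  have htr : (D - Bᴴ * A⁻¹ * B).trace.re ≤ C := by
    have := (Complex.nonneg_iff.1 hP.trace_nonneg).1
    rw [trace_sub, Complex.sub_re]; linarith
  rw [hd, Complex.mul_re, ← hApos.2, zero_mul, sub_zero]
  exact mul_le_mul_of_nonneg_left (aux_det_le _ hS C htr) hApos.1.le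

open scoped ComplexOrder in
theorem stmt_8 (T nt : ℕ) (hnt : nt ≤ T) (C : ℝ)
    (Z : Matrix (Fin T) (Fin T) ℂ) (hZ : IsUnit Z.det)
    (hC : ∑ i, ∑ j, ‖Z i j‖ ^ 2 ≤ C)
    (f : Fin nt → Fin T) (hf : Function.Injective f) :
    ‖Z.det‖ ^ 2 / C ^ (T - nt) ≤
      ((Z.submatrix f id) * (Z.submatrix f id)ᴴ).det.re := by
  classical
  have hC0 : 0 ≤ C := le_trans (by positivity) hC
  let ι := ↥(Set.range f)ᶜ
  let e : Fin nt ⊕ ι ≃ Fin T :=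
    (Equiv.sumCongr (Equiv.ofInjective f hf) (Equiv.refl _)).trans (Equiv.Set.sumCompl (Set.range f))
  have hcard : Fintype.card ι = T - nt := by
    have := Fintype.card_congr e
    simp only [Fintype.card_sum, Fintype.card_fin] at this
    omega
  have hG : (Z * Zᴴ).PosDef :=
    PosDef.mul_conjTranspose_self Z (vecMul_injective_of_isUnit ((isUnit_iff_isUnit_det Z).2 hZ))
  let g : ι → Fin T := Subtype.val
  set A := (Z.submatrix f id) * (Z.submatrix f id)ᴴ with hAdef
  have hAs : A = (Z * Zᴴ).submatrix f f := by
    ext i j; simp [hAdef, mul_apply]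
  have hA : A.PosDef := by rw [hAs]; exact hG.submatrix hf
  have hblk : (Z * Zᴴ).submatrix e e = fromBlocks A ((Z * Zᴴ).submatrix f g)
      ((Z * Zᴴ).submatrix f g)ᴴ ((Z * Zᴴ).submatrix g g) := by
    rw [conjTranspose_submatrix, hG.isHermitian.eq, hAs]
    ext (i | i) (j | j) <;> rfl
  have htr : ((Z * Zᴴ).submatrix g g).trace.re ≤ C := by
    refine le_trans ?_ hC
    have hd : ∀ i, ((Z * Zᴴ) i i).re = ∑ j, ‖Z i j‖ ^ 2 := by
      intro i
      rw [mul_apply, Complex.re_sum]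
      refine Finset.sum_congr rfl fun j _ => ?_
      rw [conjTranspose_apply, Complex.star_def, Complex.mul_conj, Complex.ofReal_re,
        Complex.normSq_eq_norm_sq]
    rw [trace, Complex.re_sum]
    simp only [diag_apply, submatrix_apply, hd]
    rw [← e.sum_comp, Fintype.sum_sum_type]
    have : 0 ≤ ∑ x, ∑ j, ‖Z (e (Sum.inl x)) j‖ ^ 2 := by positivity
    exact le_add_of_nonneg_left this
  have hps : (fromBlocks A ((Z * Zᴴ).submatrix f g)
      ((Z * Zᴴ).submatrix f g)ᴴ ((Z * Zᴴ).submatrix g g)).PosSemidef := by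
    rw [← hblk]; exact hG.posSemidef.submatrix e
  have key := aux_fischer A _ _ hps hA C htr
  rw [← hblk, det_submatrix_equiv_self, hcard, det_mul, det_conjTranspose, Complex.star_def,
    Complex.mul_conj, Complex.ofReal_re, Complex.normSq_eq_norm_sq] at key
  exact div_le_of_le_mul₀ (by positivity) (Complex.pos_iff.1 hA.det_pos).1.le key
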